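/- arXiv:1210.0124 — 3 statements merged into one kernel-verified Lean document; each statement's English description precedes it below -/
import Mathlib

section
/- Let Π ⊂ ℝ³ be a box and let f be a checkered function on Π. If ∫_Π f(x)·exp(α⟨Θ,x⟩ + iα⟨Ψ,x⟩) dx = 0 for every real α ≠ 0 and every admissible pair (Θ,Ψ), then f(x) = 0 for almost every x ∈ Π. -/
open MeasureTheory Complex

noncomputable section

/-- The half-open box `[a₁,b₁) × [a₂,b₂) × [a₃,b₃)` in `ℝ³`. -/
def box (a b : Fin 3 → ℝ) : Set (Fin 3 → ℝ) :=
  Set.univ.pi fun i => Set.Ico (a i) (b i)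

/-- A function is checkered on `P` if it is a finite linear combination of
characteristic functions of boxes contained in `P`. -/
def Checkered (P : Set (Fin 3 → ℝ)) (f : (Fin 3 → ℝ) → ℝ) : Prop :=
  ∃ (N : ℕ) (c : Fin N → ℝ) (lo hi : Fin N → Fin 3 → ℝ),
    (∀ k i, lo k i < hi k i) ∧ (∀ k, box (lo k) (hi k) ⊆ P) ∧
    f = fun x => ∑ k, c k * Set.indicator (box (lo k) (hi k)) (fun _ => (1:ℝ)) x

/-- A pair `(Θ,Ψ)` of orthogonal unit vectors in `ℝ³` is admissible if
`Θ_l + iΨ_l ≠ 0` for each `l`. -/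
def Admissible (Θ Ψ : Fin 3 → ℝ) : Prop :=
  (∑ l, Θ l ^ 2 = 1) ∧ (∑ l, Ψ l ^ 2 = 1) ∧ (∑ l, Θ l * Ψ l = 0) ∧
    ∀ l, (Θ l : ℂ) + Ψ l * Complex.I ≠ 0

theorem integral_box_exp (lo hi : Fin 3 → ℝ) (h : ∀ i, lo i < hi i) (z : Fin 3 → ℂ)
    (hz : ∀ l, z l ≠ 0) :
    ∫ x in box lo hi, Complex.exp (∑ l, z l * x l) =
      ∏ l, (Complex.exp (z l * hi l) - Complex.exp (z l * lo l)) / z l := by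
  simp_rw [Complex.exp_sum]
  rw [box, volume_pi, Measure.restrict_pi_pi,
    integral_fintype_prod_eq_prod (fun l (t : ℝ) => Complex.exp (z l * t))]
  refine Finset.prod_congr rfl fun l _ => ?_
  rw [integral_Ico_eq_integral_Ioc, ← intervalIntegral.integral_of_le (h l).le,
    integral_exp_mul_complex (hz l)]

theorem measurableSet_box (lo hi : Fin 3 → ℝ) : MeasurableSet (box lo hi) :=
  MeasurableSet.univ_pi fun _ => measurableSet_Ico

theorem integrableOn_box_exp (lo hi : Fin 3 → ℝ) (z : Fin 3 → ℂ) :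
    IntegrableOn (fun x : Fin 3 → ℝ => Complex.exp (∑ l, z l * x l)) (box lo hi) := by
  have hc : Continuous fun x : Fin 3 → ℝ => Complex.exp (∑ l, z l * x l) := by fun_prop
  refine (hc.continuousOn.integrableOn_compact (isCompact_univ_pi fun i =>
    isCompact_Icc (a := lo i) (b := hi i))).mono_set ?_
  exact Set.pi_mono fun i _ => Set.Ico_subset_Icc_self

/-- The integral of a checkered function against an exponential. -/
theorem integral_checkered_exp {P : Set (Fin 3 → ℝ)} {N : ℕ} (c : Fin N → ℝ)
    (lo hi : Fin N → Fin 3 → ℝ) (h : ∀ k i, lo k i < hi k i) (hP : ∀ k, box (lo k) (hi k) ⊆ P)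
    (z : Fin 3 → ℂ) (hz : ∀ l, z l ≠ 0) :
    ∫ x in P, ((∑ k, c k * Set.indicator (box (lo k) (hi k)) (fun _ => (1 : ℝ)) x : ℝ) : ℂ) *
        Complex.exp (∑ l, z l * x l) =
      (∑ k, c k * ∏ l, (Complex.exp (z l * hi k l) - Complex.exp (z l * lo k l))) /
        ∏ l, z l := by
  have key : ∀ x : Fin 3 → ℝ,
      ((∑ k, c k * Set.indicator (box (lo k) (hi k)) (fun _ => (1 : ℝ)) x : ℝ) : ℂ) *
        Complex.exp (∑ l, z l * x l) =
      ∑ k, (c k : ℂ) * (box (lo k) (hi k)).indicator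
        (fun y : Fin 3 → ℝ => Complex.exp (∑ l, z l * y l)) x := by
    intro x
    push_cast
    rw [Finset.sum_mul]
    refine Finset.sum_congr rfl fun k _ => ?_
    by_cases hx : x ∈ box (lo k) (hi k) <;> simp [hx]
  simp_rw [key]
  rw [integral_finsetSum, Finset.sum_div]
  · refine Finset.sum_congr rfl fun k _ => ?_
    rw [integral_const_mul, setIntegral_indicator (measurableSet_box _ _),
      Set.inter_eq_right.2 (hP k), integral_box_exp _ _ (h k) z hz, Finset.prod_div_distrib,
      mul_div_assoc]
  · intro k _
    exact (((integrableOn_box_exp (lo k) (hi k) z).integrable_indicator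
      (measurableSet_box _ _)).integrableOn).const_mul _

/-- The character `t ↦ exp (t w)` of the additive group `ℝ`. -/
def expChar (w : ℂ) : Multiplicative ℝ →* ℂ where
  toFun t := Complex.exp ((t.toAdd : ℂ) * w)
  map_one' := by simp
  map_mul' s t := by simp [add_mul, Complex.exp_add]

theorem expChar_injective : Function.Injective expChar := by
  intro w z h
  have hd : ∀ w : ℂ, HasDerivAt (fun t : ℝ => Complex.exp ((t : ℂ) * w)) w 0 := by
    intro w
    have := (((hasDerivAt_id (0 : ℝ)).ofReal_comp).mul_const w).cexp
    simpa using this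
  have he : (fun t : ℝ => Complex.exp ((t : ℂ) * w)) = fun t : ℝ => Complex.exp ((t : ℂ) * z) :=
    funext fun t => DFunLike.congr_fun h (Multiplicative.ofAdd t)
  exact (hd w).unique (he ▸ hd z)

/-- A vanishing exponential sum with exponents injective in the nodes annihilates every
function on the nodes. -/
theorem sum_mul_eq_zero_of_exp_sum_eq_zero {J E : Type*} [Fintype J] (d : J → ℂ) (v : J → E)
    (w : E → ℂ) (hw : Set.InjOn w (Set.range v))
    (h : ∀ t : ℝ, ∑ j, d j * Complex.exp (t * w (v j)) = 0) (G : E → ℂ) :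
    ∑ j, d j * G (v j) = 0 := by
  have hli : LinearIndepOn ℂ (fun p : E => (expChar (w p) : Multiplicative ℝ → ℂ))
      (Set.range v) :=
    (linearIndependent_monoidHom (Multiplicative ℝ) ℂ).comp
      (fun p : Set.range v => expChar (w p))
      (expChar_injective.comp hw.injective)
  have hD : ∑ j, Finsupp.single (v j) (d j) = 0 := by
    refine linearIndepOn_iff.1 hli _ ?_ ?_
    · exact Submodule.sum_mem _ fun j _ => Finsupp.single_mem_supported ℂ _ ⟨j, rfl⟩
    · rw [map_sum]
      funext t
      simpa [expChar] using h t.toAdd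
  simpa using congrArg (Finsupp.linearCombination ℂ G) hD

open Polynomial in
/-- There is an admissible pair whose complex combination separates the points of a finite set. -/
theorem exists_admissible_separating (S : Set (Fin 3 → ℝ)) (hS : S.Finite) :
    ∃ Θ Ψ : Fin 3 → ℝ, Admissible Θ Ψ ∧
      Set.InjOn (fun p : Fin 3 → ℝ => ∑ l, ((Θ l : ℂ) + Ψ l * Complex.I) * p l) S := by
  have hfin : ∀ u v : ℝ, u ≠ 0 ∨ v ≠ 0 → {t : ℝ | u * (1 - t ^ 2) + v * (2 * t) = 0}.Finite := by
    intro u v huv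
    have hq : (C u * (1 - X ^ 2) + C v * (2 * X) : ℝ[X]) ≠ 0 := by
      intro h0
      have e0 := congrArg (eval 0) h0
      have e1 := congrArg (eval 1) h0
      simp at e0 e1
      tauto
    refine (finite_setOfPred_isRoot hq).subset fun t ht => ?_
    simpa [IsRoot] using ht
  have hbad : ({t : ℝ | (1 : ℝ) * (1 - t ^ 2) + 0 * (2 * t) = 0} ∪
      {t : ℝ | (0 : ℝ) * (1 - t ^ 2) + 1 * (2 * t) = 0} ∪
      ⋃ pq ∈ {pq ∈ S ×ˢ S | pq.1 0 - pq.2 0 ≠ 0 ∨ pq.1 1 - pq.2 1 ≠ 0},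
        {t : ℝ | (pq.1 0 - pq.2 0) * (1 - t ^ 2) + (pq.1 1 - pq.2 1) * (2 * t) = 0}).Finite :=
    ((hfin 1 0 (by simp)).union (hfin 0 1 (by simp))).union
      (((hS.prod hS).subset (Set.sep_subset _ _)).biUnion fun pq hpq => hfin _ _ hpq.2)
  obtain ⟨t, ht⟩ := hbad.exists_notMem
  simp only [Set.mem_union, Set.mem_iUnion, not_or, not_exists, Set.mem_ofPred_eq,
    Set.mem_prod, zero_mul, one_mul, add_zero, zero_add] at ht
  obtain ⟨⟨ht1, ht2⟩, ht3⟩ := ht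
  have hpos : (1 + t ^ 2) ≠ 0 := by positivity
  refine ⟨![(1 - t ^ 2) / (1 + t ^ 2), 2 * t / (1 + t ^ 2), 0], ![0, 0, 1], ⟨?_, ?_, ?_, ?_⟩, ?_⟩
  · simp [Fin.sum_univ_three]
    field_simp
    ring
  · simp [Fin.sum_univ_three]
  · simp [Fin.sum_univ_three]
  · intro l hl
    have hre := congrArg Complex.re hl
    have him := congrArg Complex.im hl
    simp only [Complex.add_re, Complex.add_im, Complex.ofReal_re, Complex.ofReal_im,
      Complex.re_ofReal_mul, Complex.im_ofReal_mul, Complex.I_re, Complex.I_im, mul_zero,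
      mul_one, add_zero, zero_add, Complex.zero_re, Complex.zero_im] at hre him
    fin_cases l
    · exact div_ne_zero ht1 hpos hre
    · exact div_ne_zero ht2 hpos hre
    · exact one_ne_zero him
  · intro p hp q hq hpq
    have hre := congrArg Complex.re hpq
    have him := congrArg Complex.im hpq
    simp only [Fin.sum_univ_three, Complex.add_re, Complex.add_im, Complex.re_mul_ofReal,
      Complex.im_mul_ofReal, Matrix.cons_val, Complex.ofReal_re, Complex.ofReal_im,
      Complex.I_re, Complex.I_im, Complex.re_ofReal_mul, Complex.im_ofReal_mul] at hre him
    have hlin : (p 0 - q 0) * (1 - t ^ 2) + (p 1 - q 1) * (2 * t) = 0 := by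
      field_simp at hre
      linarith
    have h01 : ¬ (p 0 - q 0 ≠ 0 ∨ p 1 - q 1 ≠ 0) := fun h => ht3 (p, q) ⟨⟨hp, hq⟩, h⟩ hlin
    push Not at h01
    funext l
    fin_cases l
    · exact sub_eq_zero.1 h01.1
    · exact sub_eq_zero.1 h01.2
    · simpa using him

/-- Expansion of a product of differences over the vertices of a cube. -/
theorem prod_sub_eq_sum_vertices (lo hi : Fin 3 → ℝ) (g : Fin 3 → ℝ → ℂ) :
    ∏ l, (g l (hi l) - g l (lo l)) =
      ∑ s : Fin 3 → Bool, (∏ l, if s l then (1 : ℂ) else -1) *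
        ∏ l, g l (if s l then hi l else lo l) := by
  have : ∀ l, g l (hi l) - g l (lo l) =
      ∑ e : Bool, (if e then (1 : ℂ) else -1) * g l (if e then hi l else lo l) := by
    intro l
    simp [sub_eq_add_neg]
  simp_rw [this, Finset.prod_univ_sum, Fintype.piFinset_univ, Finset.prod_mul_distrib]

theorem indicator_box_eq_prod (lo hi : Fin 3 → ℝ) (h : ∀ i, lo i < hi i) (x : Fin 3 → ℝ) :
    (box lo hi).indicator (fun _ => (1 : ℝ)) x =
      ∏ l, ((if x l < hi l then (1 : ℝ) else 0) - if x l < lo l then 1 else 0) := by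
  have : ∀ l, ((if x l < hi l then (1 : ℝ) else 0) - if x l < lo l then 1 else 0) =
      if x l ∈ Set.Ico (lo l) (hi l) then 1 else 0 := by
    intro l
    have := h l
    simp only [Set.mem_Ico]
    split_ifs <;> grind
  rw [Finset.prod_congr rfl fun l _ => this l, Finset.prod_ite_zero, box]
  by_cases hx : ∀ l, x l ∈ Set.Ico (lo l) (hi l)
  · rw [Set.indicator_of_mem (Set.mem_univ_pi.2 hx)]
    simp only [Finset.mem_univ, true_imp_iff, if_pos hx, Finset.prod_const_one]
  · rw [Set.indicator_of_notMem (mt Set.mem_univ_pi.1 hx)]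
    simp only [Finset.mem_univ, true_imp_iff, if_neg hx]

/-- If a checkered function on a box of `ℝ³` has vanishing integral against all
exponentials `exp(α⟨Θ,x⟩ + iα⟨Ψ,x⟩)` with `α ≠ 0` and `(Θ,Ψ)` admissible, then it
vanishes almost everywhere. -/
theorem checkered_eq_zero_of_exponential_integrals_eq_zero
    (a b : Fin 3 → ℝ) (hab : ∀ i, a i < b i)
    (f : (Fin 3 → ℝ) → ℝ) (hf : Checkered (box a b) f)
    (hint : ∀ (α : ℝ), α ≠ 0 → ∀ Θ Ψ : Fin 3 → ℝ, Admissible Θ Ψ →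
      ∫ x in box a b, (f x : ℂ) *
        Complex.exp (((α * ∑ l, Θ l * x l : ℝ) : ℂ)
          + ((α * ∑ l, Ψ l * x l : ℝ) : ℂ) * Complex.I) = 0) :
    f =ᵐ[volume.restrict (box a b)] (fun _ => (0:ℝ)) := by
  obtain ⟨N, c, lo, hi, hlt, hsub, rfl⟩ := hf
  let v : Fin N × (Fin 3 → Bool) → Fin 3 → ℝ := fun j l =>
    if j.2 l then hi j.1 l else lo j.1 l
  let d : Fin N × (Fin 3 → Bool) → ℂ := fun j =>
    c j.1 * ∏ l, if j.2 l then (1 : ℂ) else -1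
  have expand : ∀ g : Fin 3 → ℝ → ℂ,
      ∑ k, (c k : ℂ) * ∏ l, (g l (hi k l) - g l (lo k l)) = ∑ j, d j * ∏ l, g l (v j l) := by
    intro g
    simp_rw [prod_sub_eq_sum_vertices, Finset.mul_sum, Fintype.sum_prod_type, d, v, mul_assoc]
  obtain ⟨Θ, Ψ, hadm, hinj⟩ := exists_admissible_separating (Set.range v) (Set.finite_range v)
  have hzero : ∀ t : ℝ, ∑ j, d j *
      Complex.exp (t * ∑ l, ((Θ l : ℂ) + Ψ l * Complex.I) * v j l) = 0 := by
    intro t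
    have hv : ∀ j, Complex.exp (t * ∑ l, ((Θ l : ℂ) + Ψ l * Complex.I) * v j l) =
        ∏ l, Complex.exp (t * ((Θ l : ℂ) + Ψ l * Complex.I) * v j l) := by
      intro j
      rw [← Complex.exp_sum, Finset.mul_sum]
      simp_rw [mul_assoc]
    simp_rw [hv]
    rw [← expand fun l (u : ℝ) => Complex.exp (t * ((Θ l : ℂ) + Ψ l * Complex.I) * u)]
    rcases eq_or_ne t 0 with rfl | ht
    · simp
    have hz : ∀ l, (t : ℂ) * ((Θ l : ℂ) + Ψ l * Complex.I) ≠ 0 := fun l =>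
      mul_ne_zero (Complex.ofReal_ne_zero.2 ht) (hadm.2.2.2 l)
    have hI := integral_checkered_exp c lo hi hlt hsub _ hz
    have hexp : ∀ x : Fin 3 → ℝ, ∑ l, (t : ℂ) * ((Θ l : ℂ) + Ψ l * Complex.I) * x l =
        ((t * ∑ l, Θ l * x l : ℝ) : ℂ) + ((t * ∑ l, Ψ l * x l : ℝ) : ℂ) * Complex.I := by
      intro x
      push_cast
      simp only [Fin.sum_univ_three]
      ring
    simp_rw [hexp] at hI
    rw [hint t ht Θ Ψ hadm, eq_comm, div_eq_zero_iff] at hI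
    exact hI.resolve_right (Finset.prod_ne_zero_iff.2 fun l _ => hz l)
  refine Filter.Eventually.of_forall fun x => ?_
  have hG := sum_mul_eq_zero_of_exp_sum_eq_zero d v _ hinj hzero
    fun p => ∏ l, if x l < p l then (1 : ℂ) else 0
  rw [← expand fun l u => if x l < u then (1 : ℂ) else 0] at hG
  simp_rw [indicator_box_eq_prod _ _ (hlt _)]
  apply Complex.ofReal_injective
  simpa [apply_ite Complex.ofReal] using hG
end
end

section
/- Let Ω ⊂ ℝ³ be a box, let Π₁,…,Π_N be boxes contained in Ω and c₁,…,c_N ∈ ℝ, and set f = Σᵢ cᵢ·χ_{Πᵢ} and f̃ = Σᵢ cᵢ·Υ(χ_{Πᵢ}). Then for every real α ≠ 0 and every admissible pair (Θ,Ψ), ∫_Ω f(x)·exp(α⟨Θ,x⟩ + iα⟨Ψ,x⟩) dx = C·Σ_v f̃(v)·exp(α⟨Θ,v⟩ + iα⟨Ψ,v⟩), where the sum runs over the (finite) support of f̃ and C = α⁻³·∏_{l=1}^{3} (Θ_l + iΨ_l)⁻¹. -/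
open MeasureTheory Complex

noncomputable section

/-- The discretization `Υ(χ_Π)` of the characteristic function of the box with lower
corner `lo` and upper corner `hi`: it takes the value `σ₁σ₂σ₃` at the vertex obtained
by choosing, in coordinate `l`, `hi l` if `σ_l = +1` and `lo l` if `σ_l = −1`. -/
def ups (lo hi : Fin 3 → ℝ) (v : Fin 3 → ℝ) : ℝ :=
  ∑ s : Fin 3 → Bool, (∏ l, if s l then (1:ℝ) else -1) *
    (if v = (fun l => if s l then hi l else lo l) then 1 else 0)

/-- The exponential of a linear form with complex coefficients `z`. -/
def expForm (z : Fin 3 → ℂ) (x : Fin 3 → ℝ) : ℂ :=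
  ∏ l, Complex.exp (z l * x l)

lemma expForm_eq_exp (α : ℝ) (Θ Ψ x : Fin 3 → ℝ) :
    Complex.exp (((α * ∑ l, Θ l * x l : ℝ) : ℂ)
        + ((α * ∑ l, Ψ l * x l : ℝ) : ℂ) * Complex.I)
      = expForm (fun l => α * ((Θ l : ℂ) + Ψ l * Complex.I)) x := by
  rw [expForm, ← Complex.exp_sum]
  congr 1
  simp only [Fin.sum_univ_three]
  push_cast
  ring

lemma continuous_expForm (z : Fin 3 → ℂ) : Continuous (expForm z) := by
  unfold expForm
  fun_prop

lemma measurableSet_box_s3 (a b : Fin 3 → ℝ) : MeasurableSet (box a b) :=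
  MeasurableSet.univ_pi fun _ => measurableSet_Ico

lemma box_subset_Icc (a b : Fin 3 → ℝ) : box a b ⊆ Set.Icc a b := fun _ hx =>
  ⟨fun i => (hx i trivial).1, fun i => (hx i trivial).2.le⟩

lemma integrableOn_expForm (z : Fin 3 → ℂ) (a b : Fin 3 → ℝ) :
    IntegrableOn (expForm z) (box a b) :=
  ((continuous_expForm z).continuousOn.integrableOn_compact isCompact_Icc).mono_set
    (box_subset_Icc a b)

/-- The integral of an exponential over a box is an alternating sum over its vertices. -/
lemma setIntegral_box_expForm (z : Fin 3 → ℂ) (hz : ∀ l, z l ≠ 0) (a b : Fin 3 → ℝ)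
    (hab : ∀ i, a i ≤ b i) :
    ∫ x in box a b, expForm z x = (∏ l, z l)⁻¹ *
      ∑ s : Fin 3 → Bool, (∏ l, if s l then (1 : ℂ) else -1) *
        expForm z (fun l => if s l then b l else a l) := by
  have hside (l : Fin 3) : ∫ t in Set.Ico (a l) (b l), Complex.exp (z l * t)
      = (z l)⁻¹ * ∑ σ : Bool, (if σ then (1 : ℂ) else -1) *
        Complex.exp (z l * ((if σ then b l else a l : ℝ) : ℂ)) := by
    rw [integral_Ico_eq_integral_Ioc, ← intervalIntegral.integral_of_le (hab l),
      integral_exp_mul_complex (hz l)]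
    simp only [Fintype.sum_bool, if_true, Bool.false_eq_true, if_false]
    ring
  unfold expForm box
  rw [volume_pi, Measure.restrict_pi_pi,
    integral_fintype_prod_eq_prod (f := fun l (t : ℝ) => Complex.exp (z l * t))]
  simp only [hside, Finset.prod_mul_distrib, Finset.prod_inv_distrib, Finset.prod_univ_sum,
    Fintype.piFinset_univ]

/-- Summing a function against `ups` evaluates it at the vertices of the box. -/
lemma ups_mul_eq_sum (lo hi : Fin 3 → ℝ) (g : (Fin 3 → ℝ) → ℂ) (v : Fin 3 → ℝ) :
    (ups lo hi v : ℂ) * g v = ∑ s : Fin 3 → Bool,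
      if v = (fun l => if s l then hi l else lo l) then
        (∏ l, if s l then (1 : ℂ) else -1) * g (fun l => if s l then hi l else lo l) else 0 := by
  rw [ups, Complex.ofReal_sum, Finset.sum_mul]
  refine Finset.sum_congr rfl fun s _ => ?_
  split_ifs with h
  · rw [← h, mul_one, Complex.ofReal_prod]
    congr 1
    exact Finset.prod_congr rfl fun l _ => by split_ifs <;> simp
  · simp

lemma finite_support_ite_eq {V : Type*} [DecidableEq V] (w : V) (y : ℂ) :
    (Function.support fun v => if v = w then y else 0).Finite :=
  (Set.finite_singleton w).subset fun v hv => by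
    by_contra h
    exact hv (if_neg h)

lemma finite_support_ups_mul (lo hi : Fin 3 → ℝ) (g : (Fin 3 → ℝ) → ℂ) :
    (Function.support fun v => (ups lo hi v : ℂ) * g v).Finite := by
  simp only [ups_mul_eq_sum]
  refine (Set.finite_iUnion fun s : Fin 3 → Bool => Set.finite_singleton
    (fun l => if s l then hi l else lo l)).subset fun v hv => ?_
  by_contra h
  simp only [Set.mem_iUnion, Set.mem_singleton_iff, not_exists] at h
  exact hv (Finset.sum_eq_zero fun s _ => if_neg (h s))

lemma finsum_ups_mul (lo hi : Fin 3 → ℝ) (g : (Fin 3 → ℝ) → ℂ) :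
    ∑ᶠ v, (ups lo hi v : ℂ) * g v = ∑ s : Fin 3 → Bool,
      (∏ l, if s l then (1 : ℂ) else -1) * g (fun l => if s l then hi l else lo l) := by
  simp only [ups_mul_eq_sum]
  rw [finsum_sum_comm _ _ fun s _ => finite_support_ite_eq _ _]
  refine Finset.sum_congr rfl fun s _ => ?_
  rw [finsum_eq_single _ (fun l => if s l then hi l else lo l) fun v hv => if_neg hv, if_pos rfl]

/-- For a checkered function `f = Σ cₖ χ_{Πₖ}` on a box `Ω ⊂ ℝ³`, the integral of `f`
against the exponential `e(x) = exp(α⟨Θ,x⟩ + iα⟨Ψ,x⟩)` equals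
`C · Σ_v f̃(v) e(v)`, where `f̃ = Σ cₖ Υ(χ_{Πₖ})`, the sum runs over the finite support
of `f̃`, and `C = α⁻³ ∏_l (Θ_l + iΨ_l)⁻¹`. -/
theorem integral_checkered_exponential
    (A B : Fin 3 → ℝ) (hAB : ∀ i, A i < B i)
    (N : ℕ) (c : Fin N → ℝ) (lo hi : Fin N → Fin 3 → ℝ)
    (hlh : ∀ k i, lo k i < hi k i)
    (hsub : ∀ k, box (lo k) (hi k) ⊆ box A B)
    (f : (Fin 3 → ℝ) → ℝ)
    (hfdef : f = fun x => ∑ k, c k * Set.indicator (box (lo k) (hi k)) (fun _ => (1:ℝ)) x)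
    (ftilde : (Fin 3 → ℝ) → ℝ)
    (hftdef : ftilde = fun v => ∑ k, c k * ups (lo k) (hi k) v)
    (α : ℝ) (hα : α ≠ 0) (Θ Ψ : Fin 3 → ℝ) (hadm : Admissible Θ Ψ) :
    ∫ x in box A B, (f x : ℂ) *
        Complex.exp (((α * ∑ l, Θ l * x l : ℝ) : ℂ)
          + ((α * ∑ l, Ψ l * x l : ℝ) : ℂ) * Complex.I)
      = ((α : ℂ) ^ 3)⁻¹ * (∏ l, ((Θ l : ℂ) + Ψ l * Complex.I))⁻¹ *
          ∑ᶠ v : Fin 3 → ℝ, (ftilde v : ℂ) *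
            Complex.exp (((α * ∑ l, Θ l * v l : ℝ) : ℂ)
              + ((α * ∑ l, Ψ l * v l : ℝ) : ℂ) * Complex.I) := by
  simp only [expForm_eq_exp]
  set z : Fin 3 → ℂ := fun l => α * ((Θ l : ℂ) + Ψ l * Complex.I) with hzdef
  have hz (l : Fin 3) : z l ≠ 0 := mul_ne_zero (by exact_mod_cast hα) (hadm.2.2.2 l)
  have hconst : ((α : ℂ) ^ 3)⁻¹ * (∏ l, ((Θ l : ℂ) + Ψ l * Complex.I))⁻¹ = (∏ l, z l)⁻¹ := by
    simp [hzdef, Finset.prod_mul_distrib, mul_comm]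
  have hf (x : Fin 3 → ℝ) : (f x : ℂ) * expForm z x
      = ∑ k, (c k : ℂ) * (box (lo k) (hi k)).indicator (expForm z) x := by
    rw [hfdef, Complex.ofReal_sum, Finset.sum_mul]
    refine Finset.sum_congr rfl fun k _ => ?_
    by_cases hx : x ∈ box (lo k) (hi k) <;> simp [hx]
  have hft (v : Fin 3 → ℝ) : (ftilde v : ℂ) * expForm z v
      = ∑ k, (c k : ℂ) * ((ups (lo k) (hi k) v : ℂ) * expForm z v) := by
    rw [hftdef, Complex.ofReal_sum, Finset.sum_mul]
    exact Finset.sum_congr rfl fun k _ => by rw [Complex.ofReal_mul, mul_assoc]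
  simp only [hf, hft, hconst]
  rw [integral_finsetSum _ fun k _ =>
      ((integrableOn_expForm z A B).integrable.indicator (measurableSet_box_s3 _ _)).const_mul _,
    finsum_sum_comm _ _ fun k _ => (finite_support_ups_mul (lo k) (hi k) (expForm z)).subset
      fun v hv => right_ne_zero_of_mul hv,
    Finset.mul_sum]
  refine Finset.sum_congr rfl fun k _ => ?_
  rw [integral_const_mul, setIntegral_indicator (measurableSet_box_s3 _ _),
    Set.inter_eq_self_of_subset_right (hsub k),
    setIntegral_box_expForm z hz _ _ fun i => (hlh k i).le,
    ← mul_finsum, finsum_ups_mul, mul_left_comm]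
end
end

section
/- Let Ω ⊂ ℝ³ be a box, let Π₁,…,Π_N be boxes contained in Ω and c₁,…,c_N ∈ ℝ, set f = Σᵢ cᵢ·χ_{Πᵢ} and f̃ = Σᵢ cᵢ·Υ(χ_{Πᵢ}). Then every node of this representation that is not artificial is a marked node. -/
open MeasureTheory

noncomputable section

/-- A point of `Ω` is a node of the representation `f = Σ cₖ χ_{Πₖ}` if each of its
coordinates is the corresponding coordinate of a vertex of one of the boxes `Πₖ`. -/
def IsNode (N : ℕ) (lo hi : Fin N → Fin 3 → ℝ) (Ω : Set (Fin 3 → ℝ))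
    (v : Fin 3 → ℝ) : Prop :=
  v ∈ Ω ∧ ∀ l : Fin 3, ∃ k, v l = lo k l ∨ v l = hi k l

/-- The vertex of the box with corners `lo` and `hi` selected by `s`. -/
def boxVertex (lo hi : Fin 3 → ℝ) (s : Fin 3 → Bool) : Fin 3 → ℝ :=
  fun l => if s l then hi l else lo l

open Classical in
/-- The vertices of the boxes of a representation. -/
def boxVertices {N : ℕ} (lo hi : Fin N → Fin 3 → ℝ) : Finset (Fin 3 → ℝ) :=
  Finset.univ.image fun q : Fin N × (Fin 3 → Bool) => boxVertex (lo q.1) (hi q.1) q.2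

lemma mem_box {a b x : Fin 3 → ℝ} : x ∈ box a b ↔ ∀ i, a i ≤ x i ∧ x i < b i := by
  simp [box]

lemma lower_le_of_box_subset {A B a b : Fin 3 → ℝ} (hab : ∀ i, a i < b i)
    (h : box a b ⊆ box A B) (i : Fin 3) : A i ≤ a i :=
  (mem_box.1 (h (mem_box.2 fun j => ⟨le_rfl, hab j⟩)) i).1

lemma sum_ups_mul (lo hi : Fin 3 → ℝ) (U : Finset (Fin 3 → ℝ)) (G : (Fin 3 → ℝ) → ℝ)
    (hU : ∀ s, boxVertex lo hi s ∈ U) :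
    ∑ u ∈ U, ups lo hi u * G u =
      ∑ s : Fin 3 → Bool, (∏ l, if s l then (1:ℝ) else -1) * G (boxVertex lo hi s) := by
  classical
  simp only [ups, Finset.sum_mul]
  rw [Finset.sum_comm]
  refine Finset.sum_congr rfl fun s _ => ?_
  rw [Finset.sum_eq_single_of_mem _ (hU s)]
  · rw [if_pos (by rfl), mul_one]
  · intro u _ hu
    rw [if_neg (by exact hu), mul_zero, zero_mul]

open Classical in
lemma indicator_box_eq_sum_vertices {lo hi : Fin 3 → ℝ} (h : ∀ i, lo i < hi i)
    (x : Fin 3 → ℝ) :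
    Set.indicator (box lo hi) (fun _ => (1:ℝ)) x =
      -∑ s : Fin 3 → Bool, (∏ l, if s l then (1:ℝ) else -1) *
        (if boxVertex lo hi s ≤ x then 1 else 0) := by
  have hprod (s : Fin 3 → Bool) : (if boxVertex lo hi s ≤ x then (1:ℝ) else 0) =
      ∏ l, if (if s l then hi l else lo l) ≤ x l then (1:ℝ) else 0 := by
    rw [Finset.prod_ite_zero]
    simp [Pi.le_def, boxVertex]
  have hfactor (l : Fin 3) : ∑ b : Bool, (if b then (1:ℝ) else -1) *
      (if (if b then hi l else lo l) ≤ x l then (1:ℝ) else 0) =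
      -(if lo l ≤ x l ∧ x l < hi l then (1:ℝ) else 0) := by
    have := h l
    rw [Fintype.sum_bool]
    simp only [if_true, Bool.false_eq_true, if_false]
    split_ifs <;> grind
  simp_rw [hprod, ← Finset.prod_mul_distrib]
  rw [← Fintype.prod_sum fun (l : Fin 3) (b : Bool) => (if b then (1:ℝ) else -1) *
      (if (if b then hi l else lo l) ≤ x l then (1:ℝ) else 0)]
  simp_rw [hfactor]
  rw [Finset.prod_neg, Finset.prod_ite_zero]
  simp only [Set.indicator_apply, mem_box, Finset.mem_univ, true_imp_iff, Finset.prod_const_one]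
  split_ifs <;> norm_num

open Classical in
lemma sum_indicator_box_eq {N : ℕ} (c : Fin N → ℝ) {lo hi : Fin N → Fin 3 → ℝ}
    (hlh : ∀ k i, lo k i < hi k i) (x : Fin 3 → ℝ) :
    ∑ k, c k * Set.indicator (box (lo k) (hi k)) (fun _ => (1:ℝ)) x =
      -∑ u ∈ boxVertices lo hi,
        (∑ k, c k * ups (lo k) (hi k) u) * (if u ≤ x then 1 else 0) := by
  simp_rw [Finset.sum_mul, mul_assoc]
  rw [Finset.sum_comm, ← Finset.sum_neg_distrib]
  refine Finset.sum_congr rfl fun k _ => ?_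
  rw [← Finset.mul_sum, sum_ups_mul (lo k) (hi k) _ (fun u => if u ≤ x then 1 else 0)
    fun s => by exact Finset.mem_image.2 ⟨(k, s), Finset.mem_univ _, rfl⟩,
    indicator_box_eq_sum_vertices (hlh k), mul_neg]

/-- A vertex lying below a point of `Ω` is a node. -/
lemma isNode_of_mem_boxVertices {A B : Fin 3 → ℝ} {N : ℕ} {lo hi : Fin N → Fin 3 → ℝ}
    (hlh : ∀ k i, lo k i < hi k i) (hsub : ∀ k, box (lo k) (hi k) ⊆ box A B)
    {u x : Fin 3 → ℝ} (hu : u ∈ boxVertices lo hi) (hx : x ∈ box A B) (hux : u ≤ x) :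
    IsNode N lo hi (box A B) u := by
  classical
  obtain ⟨⟨k, s⟩, -, rfl⟩ := Finset.mem_image.1 hu
  refine ⟨mem_box.2 fun i => ⟨?_, (hux i).trans_lt (mem_box.1 hx i).2⟩, fun i => ⟨k, ?_⟩⟩
  · have h₁ := lower_le_of_box_subset (hlh k) (hsub k) i
    have h₂ := hlh k i
    simp only [boxVertex]
    split_ifs <;> linarith
  · simp only [boxVertex]
    split_ifs <;> simp

lemma exists_pos_forall_abs_sub_lt_imp_eq (S : Finset ℝ) (a : ℝ) :
    ∃ δ > 0, ∀ w ∈ S, |w - a| < δ → w = a := by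
  have hnhds : ((S.erase a : Finset ℝ) : Set ℝ)ᶜ ∈ nhds a :=
    (S.erase a).finite_toSet.isClosed.isOpen_compl.mem_nhds (by simp)
  obtain ⟨δ, hδ, h⟩ := Metric.mem_nhds_iff.1 hnhds
  refine ⟨δ, hδ, fun w hw hlt => ?_⟩
  have := h (show w ∈ Metric.ball a δ by rwa [Metric.mem_ball, Real.dist_eq])
  by_contra hne
  exact this (by simp [hw, hne])

lemma abs_sub_le_sqrt_sum_sq (y v : Fin 3 → ℝ) (l : Fin 3) :
    |y l - v l| ≤ Real.sqrt (∑ j, (y j - v j) ^ 2) :=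
  Real.abs_le_sqrt (Finset.single_le_sum (f := fun j => (y j - v j) ^ 2)
    (fun _ _ => sq_nonneg _) (Finset.mem_univ l))

/-- Every node of the representation `f = Σ cₖ χ_{Πₖ}` that is not artificial is a
marked node: each of its coordinates is the corresponding coordinate of some
interesting node (a node where `f̃ = Σ cₖ Υ(χ_{Πₖ})` does not vanish). -/
theorem non_artificial_node_is_marked
    (A B : Fin 3 → ℝ) (hAB : ∀ i, A i < B i)
    (N : ℕ) (c : Fin N → ℝ) (lo hi : Fin N → Fin 3 → ℝ)
    (hlh : ∀ k i, lo k i < hi k i)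
    (hsub : ∀ k, box (lo k) (hi k) ⊆ box A B)
    (f : (Fin 3 → ℝ) → ℝ)
    (hfdef : f = fun x => ∑ k, c k * Set.indicator (box (lo k) (hi k)) (fun _ => (1:ℝ)) x)
    (ftilde : (Fin 3 → ℝ) → ℝ)
    (hftdef : ftilde = fun v => ∑ k, c k * ups (lo k) (hi k) v)
    (v : Fin 3 → ℝ) (hv : IsNode N lo hi (box A B) v)
    -- `v` is not artificial: there is no coordinate direction `l` and no `δ > 0` such
    -- that `f` does not change its value across the hyperplane through `v`
    -- perpendicular to `eₗ`, within the δ-neighbourhood of `v`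
    (hart : ¬ ∃ (l : Fin 3) (δ : ℝ), 0 < δ ∧
      ∀ y ∈ box A B, ∀ z ∈ box A B,
        Real.sqrt (∑ j, (y j - v j) ^ 2) < δ →
        Real.sqrt (∑ j, (z j - v j) ^ 2) < δ →
        (∀ j, j ≠ l → y j = z j) → f y = f z) :
    -- `v` is a marked node
    ∀ l : Fin 3, ∃ u : Fin 3 → ℝ,
      IsNode N lo hi (box A B) u ∧ ftilde u ≠ 0 ∧ v l = u l := by
  classical
  intro l
  by_contra hno
  push Not at hno
  apply hart
  obtain ⟨δ, hδ, hsep⟩ :=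
    exists_pos_forall_abs_sub_lt_imp_eq ((boxVertices lo hi).image fun u => u l) (v l)
  refine ⟨l, δ, hδ, fun y hy z hz hyδ hzδ hyz => ?_⟩
  have le_of_le {p q : Fin 3 → ℝ} (hp : p ∈ box A B)
      (hpδ : |p l - v l| < δ) (hqδ : |q l - v l| < δ) (hpq : ∀ j, j ≠ l → p j = q j)
      {u : Fin 3 → ℝ} (hu : u ∈ boxVertices lo hi) (hne : ftilde u ≠ 0) (hup : u ≤ p) :
      u ≤ q := by
    have hul : v l ≠ u l := hno u (isNode_of_mem_boxVertices hlh hsub hu hp hup) hne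
    intro j
    by_cases hj : j = l
    · subst hj
      have hfar : δ ≤ |u j - v j| :=
        not_lt.1 fun hlt => hul (hsep _ (Finset.mem_image_of_mem _ hu) hlt).symm
      have := hup j
      rw [abs_lt] at hpδ hqδ
      rcases le_abs.1 hfar with h | h <;> linarith
    · exact (hup j).trans_eq (hpq j hj)
  have hy' := (abs_sub_le_sqrt_sum_sq y v l).trans_lt hyδ
  have hz' := (abs_sub_le_sqrt_sum_sq z v l).trans_lt hzδ
  have hf (x : Fin 3 → ℝ) :
      f x = -∑ u ∈ boxVertices lo hi, ftilde u * (if u ≤ x then 1 else 0) := by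
    rw [hfdef, hftdef]
    exact sum_indicator_box_eq c hlh x
  rw [hf, hf]
  refine congrArg Neg.neg (Finset.sum_congr rfl fun u hu => ?_)
  by_cases hne : ftilde u = 0
  · simp [hne]
  · have hiff : u ≤ y ↔ u ≤ z :=
      ⟨le_of_le hy hy' hz' hyz hu hne,
        le_of_le hz hz' hy' (fun j hj => (hyz j hj).symm) hu hne⟩
    simp only [hiff]
end
end
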